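/- Fix a probability vector p = (p_w, p_d, p_ℓ) and two probability vectors q = (q_w, q_d, q_ℓ) and q' = (q'_w, q'_d, q'_ℓ). If q is stochastically dominated by q', i.e. q_w ≤ q'_w and q_ℓ ≥ q'_ℓ, then for every horizon N the optimal gains satisfy g*_N(p, q) ≤ g*_N(p, q'). -/

import Mathlib

noncomputable section

open Filter Topology Finset

/-- The sign of an integer score, as a real number (`sgn 0 = 0`). -/
def sgn (x : ℤ) : ℝ := if 0 < x then 1 else if x < 0 then -1 else 0

/-- Expected sign of the score after one more game played with win/draw/loss
probabilities `w, d, l`, starting from score `x`. -/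
def stepVal (w d l : ℝ) (x : ℤ) : ℝ := w * sgn (x + 1) + d * sgn x + l * sgn (x - 1)

/-- Bellman value function with `k` games remaining: `bellman p q k x = V_{N-k}^N(x)`.
With no game remaining the value is the sign of the score; otherwise Player 1 picks the
better of the offensive style `(pw, pd, pl)` and the defensive style `(qw, qd, ql)`. -/
def bellman (pw pd pl qw qd ql : ℝ) : ℕ → ℤ → ℝ
  | 0, x => sgn x
  | k + 1, x =>
      max
        (pw * bellman pw pd pl qw qd ql k (x + 1) + pd * bellman pw pd pl qw qd ql k x +
          pl * bellman pw pd pl qw qd ql k (x - 1))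
        (qw * bellman pw pd pl qw qd ql k (x + 1) + qd * bellman pw pd pl qw qd ql k x +
          ql * bellman pw pd pl qw qd ql k (x - 1))

/-- Optimal gain over `N` games: `g*_N = V_0^N(0)`. -/
def gOpt (pw pd pl qw qd ql : ℝ) (N : ℕ) : ℝ := bellman pw pd pl qw qd ql N 0

/-- The two playing styles of Player 1. -/
inductive Style
  | offense
  | defense
deriving DecidableEq

/-- Selects the probability attached to a style: `a` for offense, `b` for defense. -/
def styleP (a b : ℝ) : Style → ℝ
  | .offense => a
  | .defense => b

/-- Probability mass function of the score process `X_n` under the policy `π`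
(playing `π n x` at round `n+1` when the current score is `x`), started at `X_0 = 0`. -/
def polDist (pw pd pl qw qd ql : ℝ) (π : ℕ → ℤ → Style) : ℕ → ℤ → ℝ
  | 0, x => if x = 0 then 1 else 0
  | n + 1, x =>
      polDist pw pd pl qw qd ql π n (x - 1) * styleP pw qw (π n (x - 1)) +
      polDist pw pd pl qw qd ql π n x * styleP pd qd (π n x) +
      polDist pw pd pl qw qd ql π n (x + 1) * styleP pl ql (π n (x + 1))

/-- Gain of policy `π` over `n` games: `g_n^π = E[sign (X_n)]`. -/
def gPol (pw pd pl qw qd ql : ℝ) (π : ℕ → ℤ → Style) (n : ℕ) : ℝ :=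
  ∑' x : ℤ, polDist pw pd pl qw qd ql π n x * sgn x

/-- Probability mass function of the pair (score, switched-to-defense flag) under the
catenaccio policy: play offense until the score first reaches `+1`, then defense forever. -/
def catDist (pw pd pl qw qd ql : ℝ) : ℕ → ℤ → Bool → ℝ
  | 0, x, b => if x = 0 ∧ b = false then 1 else 0
  | n + 1, x, true =>
      catDist pw pd pl qw qd ql n (x - 1) true * qw +
      catDist pw pd pl qw qd ql n x true * qd +
      catDist pw pd pl qw qd ql n (x + 1) true * ql +
      (if x = 1 then
        catDist pw pd pl qw qd ql n 0 false * pw +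
        catDist pw pd pl qw qd ql n 1 false * pd +
        catDist pw pd pl qw qd ql n 2 false * pl
       else 0)
  | n + 1, x, false =>
      if x = 1 then 0
      else
        catDist pw pd pl qw qd ql n (x - 1) false * pw +
        catDist pw pd pl qw qd ql n x false * pd +
        catDist pw pd pl qw qd ql n (x + 1) false * pl

/-- Gain of the catenaccio policy over `N` games: `g_N^(cat) = E[sign (X_N)]`. -/
def gCat (pw pd pl qw qd ql : ℝ) (N : ℕ) : ℝ :=
  ∑' x : ℤ,
    (catDist pw pd pl qw qd ql N x false + catDist pw pd pl qw qd ql N x true) * sgn x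

/-- Gain of the catenaccio+ policy over `N` games: play catenaccio, except that if the
score after `N - 1` games is `0`, the last game is played with the better of the two
styles (offense if `pw - pl > qw - ql`, defense otherwise). -/
def gCatPlus (pw pd pl qw qd ql : ℝ) : ℕ → ℝ
  | 0 => 0
  | N + 1 =>
      ∑' x : ℤ,
        (catDist pw pd pl qw qd ql N x false *
            (if x = 0 then (if pw - pl > qw - ql then pw - pl else qw - ql)
             else stepVal pw pd pl x) +
          catDist pw pd pl qw qd ql N x true *
            (if x = 0 then (if pw - pl > qw - ql then pw - pl else qw - ql)
             else stepVal qw qd ql x))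

/-- Probability mass function of the lazy random walk with i.i.d. increments (+1 with
probability `qw`, 0 with probability `qd`, −1 with probability `ql`), started at `0`. -/
def walkDist (qw qd ql : ℝ) : ℕ → ℤ → ℝ
  | 0, x => if x = 0 then 1 else 0
  | n + 1, x =>
      walkDist qw qd ql n (x - 1) * qw + walkDist qw qd ql n x * qd +
        walkDist qw qd ql n (x + 1) * ql

/-- Fixed-style gain over `N` games for the walk with step law `(qw, qd, ql)`. -/
def gFixed (qw qd ql : ℝ) (N : ℕ) : ℝ := ∑' x : ℤ, walkDist qw qd ql N x * sgn x

/-- Probability mass function of the lazy random walk with step law `(pw, pd, pl)`,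
started at `0` and absorbed (stopped) at the level `+1`.  In particular
`stoppedDist pw pd pl n 1` is the probability that the walk reaches `+1` by time `n`. -/
def stoppedDist (pw pd pl : ℝ) : ℕ → ℤ → ℝ
  | 0, x => if x = 0 then 1 else 0
  | n + 1, x =>
      if x = 1 then
        stoppedDist pw pd pl n 1 + stoppedDist pw pd pl n 0 * pw +
          stoppedDist pw pd pl n 2 * pl
      else
        (if x - 1 = 1 then 0 else stoppedDist pw pd pl n (x - 1) * pw) +
          stoppedDist pw pd pl n x * pd +
          (if x + 1 = 1 then 0 else stoppedDist pw pd pl n (x + 1) * pl)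
theorem sgn_mono {x y : ℤ} (h : x ≤ y) : sgn x ≤ sgn y := by
  unfold sgn
  split_ifs <;> first | omega | norm_num

/-- The Bellman value is nondecreasing in the score. -/
theorem bellman_le_succ {pw pd pl qw qd ql : ℝ}
    (hpw : 0 ≤ pw) (hpd : 0 ≤ pd) (hpl : 0 ≤ pl)
    (hqw : 0 ≤ qw) (hqd : 0 ≤ qd) (hql : 0 ≤ ql) (k : ℕ) (x : ℤ) :
    bellman pw pd pl qw qd ql k x ≤ bellman pw pd pl qw qd ql k (x + 1) := by
  induction k generalizing x with
  | zero => exact sgn_mono (by omega)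
  | succ k ih =>
    have h₁ := ih (x + 1)
    have h₂ := ih x
    have h₃ := ih (x - 1)
    rw [sub_add_cancel] at h₃
    simp only [bellman, add_sub_cancel_right]
    gcongr

/-- Moving mass upwards increases the mean of a nondecreasing three-point function. -/
theorem mean_le_mean_of_dominated {w d l w' d' l' a b c : ℝ}
    (h : w + d + l = 1) (h' : w' + d' + l' = 1) (hw : w ≤ w') (hl : l' ≤ l)
    (hab : b ≤ a) (hbc : c ≤ b) :
    w * a + d * b + l * c ≤ w' * a + d' * b + l' * c := by
  obtain rfl : d = 1 - w - l := by linarith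
  obtain rfl : d' = 1 - w' - l' := by linarith
  linarith [mul_nonneg (sub_nonneg.2 hw) (sub_nonneg.2 hab),
    mul_nonneg (sub_nonneg.2 hl) (sub_nonneg.2 hbc)]

theorem bellman_mono_of_stochastic_domination {pw pd pl qw qd ql qw' qd' ql' : ℝ}
    (hpw : 0 ≤ pw) (hpd : 0 ≤ pd) (hpl : 0 ≤ pl)
    (hqw : 0 ≤ qw) (hqd : 0 ≤ qd) (hql : 0 ≤ ql) (hq : qw + qd + ql = 1)
    (hqw' : 0 ≤ qw') (hqd' : 0 ≤ qd') (hql' : 0 ≤ ql') (hq' : qw' + qd' + ql' = 1)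
    (hdomw : qw ≤ qw') (hdoml : ql' ≤ ql) (k : ℕ) (x : ℤ) :
    bellman pw pd pl qw qd ql k x ≤ bellman pw pd pl qw' qd' ql' k x := by
  induction k generalizing x with
  | zero => exact le_rfl
  | succ k ih =>
    have h₁ := ih (x + 1)
    have h₂ := ih x
    have h₃ := ih (x - 1)
    have hup := bellman_le_succ hpw hpd hpl hqw' hqd' hql' k x
    have hdown := bellman_le_succ hpw hpd hpl hqw' hqd' hql' k (x - 1)
    rw [sub_add_cancel] at hdown
    refine max_le_max (by gcongr) (le_trans ?_
      (mean_le_mean_of_dominated hq hq' hdomw hdoml hup hdown))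
    gcongr

/-- If the defensive style `q' = (qw', qd', ql')` stochastically
dominates `q = (qw, qd, ql)`, i.e. `qw ≤ qw'` and `ql ≥ ql'`, then for every horizon `N`
the optimal gains satisfy `g*_N(p, q) ≤ g*_N(p, q')`. -/
theorem gOpt_mono_of_stochastic_domination
    (pw pd pl qw qd ql qw' qd' ql' : ℝ)
    (hpw : 0 ≤ pw) (hpd : 0 ≤ pd) (hpl : 0 ≤ pl) (hp : pw + pd + pl = 1)
    (hqw : 0 ≤ qw) (hqd : 0 ≤ qd) (hql : 0 ≤ ql) (hq : qw + qd + ql = 1)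
    (hqw' : 0 ≤ qw') (hqd' : 0 ≤ qd') (hql' : 0 ≤ ql') (hq' : qw' + qd' + ql' = 1)
    (hdomw : qw ≤ qw') (hdoml : ql' ≤ ql)
    (N : ℕ) :
    gOpt pw pd pl qw qd ql N ≤ gOpt pw pd pl qw' qd' ql' N := by
  exact bellman_mono_of_stochastic_domination hpw hpd hpl hqw hqd hql hq hqw' hqd' hql' hq'
    hdomw hdoml N 0
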